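/- Let G be a vertex-minimal triangle-free, fork-free graph with chromatic number at least 4, and let C be a good 5-cycle in G. Suppose u1, u2 are adjacent vertices at distance exactly 2 from C, v is a vertex of C, a1 is a common neighbor of v and u1, and b1 is a neighbor of v not on C. Then u1 is adjacent to b1. -/

import Mathlib

open SimpleGraph

set_option linter.unusedVariables false
set_option linter.unnecessarySimpa false

/-- The fork: `K_{1,4}` with two edges subdivided. Vertex 0 is the center,
adjacent to leaves 1, 2 and to 3, 5; paths 0-3-4 and 0-5-6. -/
def fork : SimpleGraph (Fin 7) :=
  SimpleGraph.fromEdgeSet {s(0, 1), s(0, 2), s(0, 3), s(0, 5), s(3, 4), s(5, 6)}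

/-- A graph is fork-free if it has no induced subgraph isomorphic to the fork. -/
def ForkFree {V : Type} (G : SimpleGraph V) : Prop :=
  IsEmpty (fork ↪g G)

/-- `G` is a vertex-minimal triangle-free, fork-free graph with chromatic
number at least 4: every smaller triangle-free fork-free graph is 3-colorable. -/
def MinCex {V : Type} [Fintype V] (G : SimpleGraph V) : Prop :=
  G.CliqueFree 3 ∧ ForkFree G ∧ 4 ≤ G.chromaticNumber ∧
    ∀ (W : Type) [Fintype W] (H : SimpleGraph W),
      Fintype.card W < Fintype.card V → H.CliqueFree 3 → ForkFree H →
        H.chromaticNumber ≤ 3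

/-- `c` describes a 5-cycle in `G`. -/
def IsC5 {V : Type} (G : SimpleGraph V) (c : Fin 5 → V) : Prop :=
  Function.Injective c ∧ ∀ i : Fin 5, G.Adj (c i) (c (i + 1))

/-- Distance from a vertex `u` to the 5-cycle `c`. -/
noncomputable def distC {V : Type} (G : SimpleGraph V) (c : Fin 5 → V) (u : V) : ℕ :=
  Finset.univ.inf' Finset.univ_nonempty fun i => G.dist u (c i)

/-- A good 5-cycle: one minimizing the number of vertices at distance at least 2. -/
def GoodC5 {V : Type} (G : SimpleGraph V) (c : Fin 5 → V) : Prop :=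
  IsC5 G c ∧ ∀ d : Fin 5 → V, IsC5 G d →
    {u : V | 2 ≤ distC G c u}.ncard ≤ {u : V | 2 ≤ distC G d u}.ncard


/-- Triangle-free and fork-free, in the form of first-order facts about a relation. -/
structure TF {V : Type} (R : V → V → Prop) : Prop where
  symm : ∀ x y, R x y → R y x
  irr : ∀ x, ¬ R x x
  tri : ∀ x y z, R x y → R y z → R x z → False
  frk : ∀ x y z p p2 q q2, ¬ R x y ∨ ¬ R x z ∨ ¬ R x p ∨ ¬ R x q ∨ ¬ R p p2 ∨
    ¬ R q q2 ∨ y = z ∨ R p2 y ∨ R p2 z ∨ R p2 q ∨ R p2 q2 ∨ R q2 y ∨ R q2 z ∨ R q2 p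

/-- The basic configuration: a 5-cycle, `u1 u2` far from it, `a`, `b` attached. -/
structure Base {V : Type} (R : V → V → Prop) (c0 c1 c2 c3 c4 u1 u2 a b : V) : Prop where
  e01 : R c0 c1
  e12 : R c1 c2
  e23 : R c2 c3
  e34 : R c3 c4
  e40 : R c4 c0
  eu : R u1 u2
  eua : R u1 a
  nub : ¬ R u1 b
  n10 : ¬ R u1 c0
  n11 : ¬ R u1 c1
  n12 : ¬ R u1 c2
  n13 : ¬ R u1 c3
  n14 : ¬ R u1 c4
  n20 : ¬ R u2 c0
  n21 : ¬ R u2 c1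
  n22 : ¬ R u2 c2
  n23 : ¬ R u2 c3
  n24 : ¬ R u2 c4
  a0 : R a c0
  a2 : R a c2
  b0 : R b c0
  b3 : R b c3
  bne1 : b ≠ c1
  bne4 : b ≠ c4

section Combi
variable {V : Type} {R : V → V → Prop} {c0 c1 c2 c3 c4 u1 u2 a b w m : V}

theorem c_caseI (T : TF R) (B : Base R c0 c1 c2 c3 c4 u1 u2 a b) {z : V}
    (h1 : R w c1) (h2 : ¬ R w c0) (h3 : ¬ R w c2) (h4 : ¬ R w c3) (h5 : ¬ R w c4)
    (h6 : ¬ R w a) (h7 : R w u1) (h8 : R z c4) (h9 : ¬ R z b) : False := by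
  obtain ⟨symm, irr, tri, frk⟩ := T
  cases B
  have f0 := frk u1 u2 w a c2 z c4
  have f1 := frk c1 c0 z c2 c3 w u1
  have f2 := frk a c0 z c2 c3 u1 w
  have f3 := frk c0 b c1 a u1 c4 z
  have f4 := frk z a u2 c4 c3 w c1
  have f5 := frk u1 a u2 w c1 z c4
  have f6 := frk a c0 z c2 c3 u1 u2
  clear frk
  grind (splits := 60) (gen := 20) (ematch := 20) (instances := 20000)

theorem c_wb (T : TF R) (B : Base R c0 c1 c2 c3 c4 u1 u2 a b)
    (h1 : R w c1) (h2 : ¬ R w c0) (h3 : ¬ R w c2) (h4 : ¬ R w c3) (h5 : ¬ R w c4)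
    (h6 : ¬ R w a) (h7 : ¬ R w u1) (h8 : ¬ R w b) : False := by
  obtain ⟨symm, irr, tri, frk⟩ := T
  cases B
  have f0 := frk c0 b c4 a u1 c1 w
  clear frk
  grind (splits := 60) (gen := 20) (ematch := 20) (instances := 20000)

theorem c_mc4 (T : TF R) (B : Base R c0 c1 c2 c3 c4 u1 u2 a b)
    (h1 : R w c1) (h2 : ¬ R w c0) (h3 : ¬ R w c2) (h4 : ¬ R w c3) (h5 : ¬ R w c4)
    (h6 : ¬ R w a) (h7 : ¬ R w u1) (h8 : R w b) (h9 : R m c1) (h10 : ¬ R m c0) (h11 : ¬ R m c2)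
    (h12 : ¬ R m c3) (h13 : ¬ R m c4) (h14 : ¬ R m a) (h15 : ¬ R m b) : False := by
  obtain ⟨symm, irr, tri, frk⟩ := T
  cases B
  have f0 := frk c0 b c4 a u1 c1 m
  have f1 := frk c1 c2 w c0 c4 m u1
  clear frk
  grind (splits := 60) (gen := 20) (ematch := 20) (instances := 20000)

theorem c_wu2 (T : TF R) (B : Base R c0 c1 c2 c3 c4 u1 u2 a b) {t : V}
    (h1 : R w c1) (h2 : ¬ R w c0) (h3 : ¬ R w c2) (h4 : ¬ R w c3) (h5 : ¬ R w c4)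
    (h6 : ¬ R w a) (h7 : ¬ R w u1) (h8 : R w b) (h9 : ¬ R w u2) (h10 : R m c4) (h11 : ¬ R m c0)
    (h12 : ¬ R m c2) (h13 : ¬ R m c3) (h14 : ¬ R m a) (h15 : ¬ R m b) (h16 : R t u2)
    (ht : R t c0 ∨ R t c1 ∨ R t c2 ∨ R t c3 ∨ R t c4) : False := by
  obtain ⟨symm, irr, tri, frk⟩ := T
  cases B
  have f0 := frk b c0 w c3 c2 u2 u1
  have f1 := frk c2 a c1 c3 c4 t u2
  have f2 := frk c1 c0 w c2 c3 m u2
  have f3 := frk c3 b c4 c2 c1 t u2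
  have f4 := frk c0 b c4 a c2 t u2
  have f5 := frk c4 c3 m c0 a t u2
  have f6 := frk c0 b c1 a u1 c4 m
  have f7 := frk c4 c0 m c3 c2 t u2
  have f8 := frk c1 c2 w c0 c4 t u2
  clear frk
  grind (splits := 60) (gen := 20) (ematch := 20) (instances := 20000)

theorem c_m1 (T : TF R) (B : Base R c0 c1 c2 c3 c4 u1 u2 a b)
    (h1 : R w c1) (h2 : ¬ R w c0) (h3 : ¬ R w c2) (h4 : ¬ R w c3) (h5 : ¬ R w c4)
    (h6 : ¬ R w a) (h7 : ¬ R w u1) (h8 : R w b) (h9 : R w u2) (h10 : R m c4) (h11 : R m c1)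
    (h12 : ¬ R m u2) (h13 : ¬ R m c0) (h14 : ¬ R m c2) (h15 : ¬ R m c3) (h16 : ¬ R m a)
    (h17 : ¬ R m b) : False := by
  obtain ⟨symm, irr, tri, frk⟩ := T
  cases B
  have f0 := frk c1 c0 m c2 c3 w u2
  clear frk
  grind (splits := 60) (gen := 20) (ematch := 20) (instances := 20000)

theorem c_m2 (T : TF R) (B : Base R c0 c1 c2 c3 c4 u1 u2 a b)
    (h1 : R m c4) (h2 : ¬ R m c1) (h3 : ¬ R m u1) (h4 : ¬ R m c0) (h5 : ¬ R m c2)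
    (h6 : ¬ R m c3) (h7 : ¬ R m a) (h8 : ¬ R m b) : False := by
  obtain ⟨symm, irr, tri, frk⟩ := T
  cases B
  have f0 := frk c0 b c1 a u1 c4 m
  clear frk
  grind (splits := 60) (gen := 20) (ematch := 20) (instances := 20000)

theorem c_pp (T : TF R) (B : Base R c0 c1 c2 c3 c4 u1 u2 a b) {p : V}
    (h1 : R m c4) (h2 : R m c1) (h3 : R m u2) (h4 : ¬ R m c0) (h5 : ¬ R m c2) (h6 : ¬ R m c3)
    (h7 : ¬ R m a) (h8 : ¬ R m b) (h9 : R p c0) (h10 : ¬ R p c1) (h11 : ¬ R p c2)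
    (h12 : ¬ R p c3) (h13 : ¬ R p c4) (h14 : ¬ R p m) : False := by
  obtain ⟨symm, irr, tri, frk⟩ := T
  cases B
  have f0 := frk c0 a p b c3 c1 m
  clear frk
  grind (splits := 60) (gen := 20) (ematch := 20) (instances := 20000)

theorem c_ll (T : TF R) (B : Base R c0 c1 c2 c3 c4 u1 u2 a b) {l f : V}
    (h1 : R w c1) (h2 : ¬ R w c0) (h3 : ¬ R w c2) (h4 : ¬ R w c3) (h5 : ¬ R w c4)
    (h6 : ¬ R w a) (h7 : ¬ R w u1) (h8 : R w b) (h9 : R w u2) (h10 : R m c4) (h11 : R m u1)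
    (h12 : ¬ R m c1) (h13 : ¬ R m c0) (h14 : ¬ R m c2) (h15 : ¬ R m c3) (h16 : ¬ R m a)
    (h17 : ¬ R m b) (h18 : ¬ R l c0) (h19 : ¬ R l c4) (h20 : ¬ R l u1) (h21 : ¬ R l a)
    (h22 : ¬ R l m) (hl : R l c1 ∨ R l c2 ∨ R l c3) (hlw : l ≠ w) (h23 : R f w) (h24 : ¬ R f l) : False := by
  obtain ⟨symm, irr, tri, frk⟩ := T
  cases B
  have f0 := frk c3 b l c2 a c4 m
  have f1 := frk c0 a f c1 l c4 m
  have f2 := frk c0 a b c1 l c4 m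
  have f3 := frk c0 c4 f a u1 c1 l
  have f4 := frk c2 c1 l a u1 c3 c4
  have f5 := frk b c0 l c3 c2 w f
  have f6 := frk c1 c2 l c0 c4 w f
  have f7 := frk b c3 l c0 a w f
  clear frk
  grind (splits := 60) (gen := 20) (ematch := 20) (instances := 20000)

end Combi

theorem forkFree_frk {V : Type} {G : SimpleGraph V} (hT : G.CliqueFree 3) (hF : ForkFree G)
    (x y z p p2 q q2 : V) :
    ¬ G.Adj x y ∨ ¬ G.Adj x z ∨ ¬ G.Adj x p ∨ ¬ G.Adj x q ∨ ¬ G.Adj p p2 ∨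
    ¬ G.Adj q q2 ∨ y = z ∨ G.Adj p2 y ∨ G.Adj p2 z ∨ G.Adj p2 q ∨ G.Adj p2 q2 ∨
    G.Adj q2 y ∨ G.Adj q2 z ∨ G.Adj q2 p := by
  classical
  by_contra hcon
  simp only [not_or, not_not] at hcon
  obtain ⟨e1, e2, e3, e4, e5, e6, hne, n1, n2, n3, n4, n5, n6, n7⟩ := hcon
  have tri : ∀ a b c, G.Adj a b → G.Adj b c → G.Adj a c → False := by
    intro a b c h1 h2 h3
    exact hT {a, b, c} (SimpleGraph.is3Clique_triple_iff.2 ⟨h1, h3, h2⟩)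
  have symm : ∀ a b, G.Adj a b → G.Adj b a := fun a b h => h.symm
  have irr : ∀ a, ¬ G.Adj a a := fun a h => h.ne rfl
  have m1 : ¬ G.Adj y z := fun h => tri x y z e1 h e2
  have m2 : ¬ G.Adj y p := fun h => tri x y p e1 h e3
  have m3 : ¬ G.Adj y q := fun h => tri x y q e1 h e4
  have m4 : ¬ G.Adj z p := fun h => tri x z p e2 h e3
  have m5 : ¬ G.Adj z q := fun h => tri x z q e2 h e4
  have m6 : ¬ G.Adj p q := fun h => tri x p q e3 h e4
  have m7 : ¬ G.Adj x p2 := fun h => tri x p p2 e3 e5 h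
  have m8 : ¬ G.Adj x q2 := fun h => tri x q q2 e4 e6 h
  refine hF.false ⟨⟨![x, y, z, p, p2, q, q2], ?_⟩, ?_⟩
  · have d : [x, y, z, p, p2, q, q2].Nodup := by
      simp only [List.nodup_cons, List.mem_cons, List.not_mem_nil, or_false, not_or, not_false_eq_true, List.nodup_nil, and_true]
      refine ⟨⟨?_, ?_, ?_, ?_, ?_, ?_⟩, ⟨?_, ?_, ?_, ?_, ?_⟩, ⟨?_, ?_, ?_, ?_⟩, ⟨?_, ?_, ?_⟩,
        ⟨?_, ?_⟩, ?_⟩ <;> grind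
    intro i j hij
    have := List.nodup_iff_injective_get.1 d
    apply this
    fin_cases i <;> fin_cases j <;> simpa using hij
  · intro i j
    have hs : ∀ a b, G.Adj a b ↔ G.Adj b a := fun a b => G.adj_comm a b
    change G.Adj (![x, y, z, p, p2, q, q2] i) (![x, y, z, p, p2, q, q2] j) ↔ fork.Adj i j
    fin_cases i <;> fin_cases j <;> simp [fork] <;> grind

theorem TF_of {V : Type} {G : SimpleGraph V} (hT : G.CliqueFree 3) (hF : ForkFree G) :
    TF G.Adj where
  symm := fun _ _ h => h.symm
  irr := fun _ h => h.ne rfl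
  tri := fun a b c h1 h2 h3 => by
    classical
    exact hT {a, b, c} (SimpleGraph.is3Clique_triple_iff.2 ⟨h1, h3, h2⟩)
  frk := forkFree_frk hT hF

/-- No vertex of a minimal counterexample is dominated by a non-adjacent vertex. -/
theorem MinCex.nondom {V : Type} [Fintype V] {G : SimpleGraph V} (hG : MinCex G) (x y : V)
    (hxy : x ≠ y) : ∃ z, G.Adj z x ∧ ¬ G.Adj z y := by
  classical
  obtain ⟨hT, hF, h4, hmin⟩ := hG
  by_contra hcon
  push Not at hcon
  let H : SimpleGraph {v : V // v ≠ x} := G.comap Subtype.val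
  let e : H ↪g G := SimpleGraph.Embedding.comap ⟨Subtype.val, Subtype.val_injective⟩ G
  have hcol : H.chromaticNumber ≤ 3 := by
    apply hmin
    · exact Fintype.card_subtype_lt (x := x) (by simp)
    · exact hT.comap ⟨e.toCopy⟩
    · exact ⟨fun f => hF.false (e.comp f)⟩
  obtain ⟨C⟩ := (SimpleGraph.chromaticNumber_le_iff_colorable (n := 3)).1 (by exact_mod_cast hcol)
  have key : ∀ u v, G.Adj u v → (fun v => if h : v = x then C ⟨y, hxy.symm⟩ else C ⟨v, h⟩) u ≠
      (fun v => if h : v = x then C ⟨y, hxy.symm⟩ else C ⟨v, h⟩) v := by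
    intro u v huv
    by_cases hu : u = x
    · by_cases hv : v = x
      · exact absurd (hu.trans hv.symm) huv.ne
      · simp only [hu, hv, dite_true, dite_false]
        subst hu
        exact C.valid (show G.Adj y v from (hcon v huv.symm).symm)
    · by_cases hv : v = x
      · simp only [hu, hv, dite_true, dite_false]
        subst hv
        exact C.valid (show G.Adj u y from hcon u huv)
      · simp only [hu, hv, dite_false]
        exact C.valid (show G.Adj u v from huv)
  have h3 : G.chromaticNumber ≤ (3 : ℕ) :=
    SimpleGraph.chromaticNumber_le_iff_colorable.2 ⟨SimpleGraph.Coloring.mk _ (fun {u v} h => key u v h)⟩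
  have h43 : (4 : ℕ∞) ≤ (3 : ℕ) := h4.trans h3
  exact absurd h43 (by decide)

/-- `u` is on the cycle or adjacent to it. -/
def Near {V : Type} (G : SimpleGraph V) (c : Fin 5 → V) (u : V) : Prop :=
  ∃ i, u = c i ∨ G.Adj u (c i)

theorem distC_lt_of_near {V : Type} {G : SimpleGraph V} {c : Fin 5 → V} {u : V}
    (h : Near G c u) : distC G c u < 2 := by
  obtain ⟨i, hi⟩ := h
  have h1 : distC G c u ≤ G.dist u (c i) := Finset.inf'_le _ (Finset.mem_univ i)
  rcases hi with rfl | hi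
  · rw [SimpleGraph.dist_self] at h1; omega
  · rw [SimpleGraph.dist_eq_one_iff_adj.2 hi] at h1; omega

theorem near_of_distC_lt {V : Type} {G : SimpleGraph V} {c : Fin 5 → V} {u : V}
    (hc : IsC5 G c) (i0 : Fin 5) (hr : G.Reachable u (c i0)) (h : distC G c u < 2) :
    Near G c u := by
  have hcr : ∀ i, G.Reachable (c 0) (c i) := by
    have h0 := (hc.2 0).reachable
    have h1 := (hc.2 1).reachable
    have h2 := (hc.2 2).reachable
    have h3 := (hc.2 3).reachable
    intro i
    fin_cases i
    · exact SimpleGraph.Reachable.refl _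
    · exact h0
    · exact h0.trans h1
    · exact (h0.trans h1).trans h2
    · exact ((h0.trans h1).trans h2).trans h3
  obtain ⟨i, -, hi⟩ := Finset.exists_mem_eq_inf' Finset.univ_nonempty fun i => G.dist u (c i)
  have hi' : distC G c u = G.dist u (c i) := hi
  have hri : G.Reachable u (c i) := (hr.trans (hcr i0).symm).trans (hcr i)
  refine ⟨i, ?_⟩
  by_cases h0 : u = c i
  · exact Or.inl h0
  · right
    have := hri.pos_dist_of_ne h0
    exact SimpleGraph.dist_eq_one_iff_adj.1 (by omega)

theorem lost_of {V : Type} [Fintype V] {G : SimpleGraph V} {c : Fin 5 → V} (hc : GoodC5 G c)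
    {d : Fin 5 → V} (hd : IsC5 G d) (hcd : ∃ j i, d j = c i) :
    (∀ g, 2 ≤ distC G c g → Near G d g → ∃ w, Near G c w ∧ ¬ Near G d w) ∧
    (∀ g1 g2 w0, g1 ≠ g2 → 2 ≤ distC G c g1 → 2 ≤ distC G c g2 → Near G d g1 → Near G d g2 →
      ∃ w, w ≠ w0 ∧ Near G c w ∧ ¬ Near G d w) := by
  classical
  have hle := hc.2 d hd
  set A := {u : V | 2 ≤ distC G c u}
  set B := {u : V | 2 ≤ distC G d u}
  have hle2 : (A \ B).ncard ≤ (B \ A).ncard := by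
    have h1 := Set.ncard_inter_add_ncard_sdiff_eq_ncard A B (Set.toFinite _)
    have h2 := Set.ncard_inter_add_ncard_sdiff_eq_ncard B A (Set.toFinite _)
    rw [Set.inter_comm] at h2
    omega
  have hw : ∀ w ∈ B \ A, Near G c w ∧ ¬ Near G d w := by
    rintro w ⟨hB, hA⟩
    have hB' : 2 ≤ distC G d w := hB
    have hA' : ¬ 2 ≤ distC G c w := hA
    have hnd : ¬ Near G d w := fun h => by have := distC_lt_of_near h; omega
    refine ⟨?_, hnd⟩
    obtain ⟨j, i, hji⟩ := hcd
    have h1 : distC G d w ≤ G.dist w (d j) := Finset.inf'_le _ (Finset.mem_univ j)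
    have hr : G.Reachable w (d j) := SimpleGraph.Reachable.of_dist_ne_zero (by omega)
    rw [hji] at hr
    exact near_of_distC_lt hc.1 i hr (by omega)
  have hg : ∀ g, 2 ≤ distC G c g → Near G d g → g ∈ A \ B := by
    intro g h1 h2
    refine ⟨h1, fun h3 => ?_⟩
    have h3' : 2 ≤ distC G d g := h3
    have := distC_lt_of_near h2
    omega
  constructor
  · intro g h1 h2
    have hpos : 0 < (A \ B).ncard := (Set.ncard_pos (Set.toFinite _)).2 ⟨g, hg g h1 h2⟩
    obtain ⟨w, hwm⟩ := (Set.ncard_pos (Set.toFinite _)).1 (lt_of_lt_of_le hpos hle2)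
    exact ⟨w, hw w hwm⟩
  · intro g1 g2 w0 hne h1 h2 h3 h4
    have hpos : 1 < (A \ B).ncard :=
      (Set.one_lt_ncard (Set.toFinite _)).2 ⟨g1, hg g1 h1 h3, g2, hg g2 h2 h4, hne⟩
    obtain ⟨w, hwm, hw0⟩ := Set.exists_ne_of_one_lt_ncard (lt_of_lt_of_le hpos hle2) w0
    exact ⟨w, hw0, hw w hwm⟩

theorem isC5_mk {V : Type} {G : SimpleGraph V} (T : TF G.Adj) {d0 d1 d2 d3 d4 : V}
    (h0 : G.Adj d0 d1) (h1 : G.Adj d1 d2) (h2 : G.Adj d2 d3) (h3 : G.Adj d3 d4)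
    (h4 : G.Adj d4 d0) : IsC5 G ![d0, d1, d2, d3, d4] := by
  obtain ⟨symm, irr, tri, -⟩ := T
  constructor
  · have d : [d0, d1, d2, d3, d4].Nodup := by
      simp only [List.nodup_cons, List.mem_cons, List.not_mem_nil, or_false, not_or,
        not_false_eq_true, List.nodup_nil, and_true]
      refine ⟨⟨?_, ?_, ?_, ?_⟩, ⟨?_, ?_, ?_⟩, ⟨?_, ?_⟩, ?_⟩ <;> grind
    intro i j hij
    have := List.nodup_iff_injective_get.1 d
    apply this
    fin_cases i <;> fin_cases j <;> simpa using hij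
  · intro i
    fin_cases i
    · exact h0
    · exact h1
    · exact h2
    · exact h3
    · exact h4

theorem near_mk {V : Type} {G : SimpleGraph V} {d0 d1 d2 d3 d4 u : V} :
    Near G ![d0, d1, d2, d3, d4] u ↔ (u = d0 ∨ u = d1 ∨ u = d2 ∨ u = d3 ∨ u = d4 ∨
      G.Adj u d0 ∨ G.Adj u d1 ∨ G.Adj u d2 ∨ G.Adj u d3 ∨ G.Adj u d4) := by
  simp only [Near, Fin.exists_fin_succ, Fin.exists_fin_zero]
  simp
  tauto

/-- The combinatorial core: a normalised configuration is impossible. -/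
theorem core_false {V : Type} [Fintype V] {G : SimpleGraph V} (hG : MinCex G)
    {c : Fin 5 → V} (hc : GoodC5 G c) {c0 c1 c2 c3 c4 u1 u2 a b : V}
    (hrange : ∀ u, Near G c u ↔ Near G ![c0, c1, c2, c3, c4] u)
    (hc0 : ∃ i, c0 = c i) (hc4 : ∃ i, c4 = c i)
    (h1 : 2 ≤ distC G c u1) (h2 : 2 ≤ distC G c u2)
    (ht : ∃ t, G.Adj t u2 ∧
      (G.Adj t c0 ∨ G.Adj t c1 ∨ G.Adj t c2 ∨ G.Adj t c3 ∨ G.Adj t c4))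
    (B : Base G.Adj c0 c1 c2 c3 c4 u1 u2 a b) : False := by
  have T : TF G.Adj := TF_of hG.1 hG.2.1
  have hB := B
  obtain ⟨e01, e12, e23, e34, e40, eu, eua, nub, n10, n11, n12, n13, n14, n20, n21, n22, n23, n24,
    a0, a2, b0, b3, bne1, bne4⟩ := hB
  have symm := T.symm
  have irr := T.irr
  have tri := T.tri
  obtain ⟨i0, hi0⟩ := hc0
  obtain ⟨i4, hi4⟩ := hc4
  -- the vertex w, lost when c1 is replaced by a
  obtain ⟨w, hwC, hwD⟩ := (lost_of hc (isC5_mk T a0.symm a2 e23 e34 e40) ⟨0, i0, hi0⟩).1 u1 h1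
    (near_mk.2 (by grind))
  rw [hrange, near_mk] at hwC
  rw [near_mk] at hwD
  simp only [not_or] at hwD
  obtain ⟨w1, w2, w3, w4, w5, w6, w7, w8, w9, w10⟩ := hwD
  have hw1 : G.Adj w c1 := by grind
  -- z is a neighbour of c4 but not of b
  obtain ⟨z, hz4, hzb⟩ := hG.nondom c4 b bne4.symm
  have hwu : ¬ G.Adj w u1 := fun h => c_caseI T B hw1 w6 w8 w9 w10 w7 h hz4 hzb
  have hwb : G.Adj w b := by
    by_contra h
    exact c_wb T B hw1 w6 w8 w9 w10 w7 hwu h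
  -- the vertex m, lost when c1, c4 are replaced by a, b
  obtain ⟨m, hmC, hmD⟩ := (lost_of hc (isC5_mk T a0.symm a2 e23 b3.symm b0) ⟨0, i0, hi0⟩).1 u1 h1
    (near_mk.2 (by grind))
  rw [hrange, near_mk] at hmC
  rw [near_mk] at hmD
  simp only [not_or] at hmD
  obtain ⟨m1, m2, m3, m4, m5, m6, m7, m8, m9, m10⟩ := hmD
  have hm4 : G.Adj m c4 := by
    by_contra h
    have hm1 : G.Adj m c1 := by grind
    exact c_mc4 T B hw1 w6 w8 w9 w10 w7 hwu hwb hm1 m6 m8 m9 h m7 m10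
  obtain ⟨t, htu, htc⟩ := ht
  have hwu2 : G.Adj w u2 := by
    by_contra h
    exact c_wu2 T B hw1 w6 w8 w9 w10 w7 hwu hwb h hm4 m6 m8 m9 m7 m10 htu htc
  by_cases hm1 : G.Adj m c1
  · have hmu2 : G.Adj m u2 := by
      by_contra h
      exact c_m1 T B hw1 w6 w8 w9 w10 w7 hwu hwb hwu2 hm4 hm1 h m6 m8 m9 m7 m10
    -- p is lost when c0 is replaced by m
    obtain ⟨p, hpC, hpD⟩ := (lost_of hc (isC5_mk T hm1 e12 e23 e34 hm4.symm) ⟨4, i4, hi4⟩).1 u2 h2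
      (near_mk.2 (by grind))
    rw [hrange, near_mk] at hpC
    rw [near_mk] at hpD
    simp only [not_or] at hpD
    obtain ⟨p1, p2, p3, p4, p5, p6, p7, p8, p9, p10⟩ := hpD
    have hp0 : G.Adj p c0 := by grind
    exact c_pp T B hm4 hm1 hmu2 m6 m8 m9 m7 m10 hp0 p7 p8 p9 p10 p6
  · have hmu1 : G.Adj m u1 := by
      by_contra h
      exact c_m2 T B hm4 hm1 h m6 m8 m9 m7 m10
    -- l is a second vertex lost for the cycle c0 a u1 m c4
    obtain ⟨l, hlw, hlC, hlD⟩ :=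
      (lost_of hc (isC5_mk T a0.symm eua.symm hmu1.symm hm4 e40) ⟨0, i0, hi0⟩).2 u1 u2 w
        eu.ne h1 h2 (near_mk.2 (by grind)) (near_mk.2 (by grind))
    rw [hrange, near_mk] at hlC
    rw [near_mk] at hlD
    simp only [not_or] at hlD
    obtain ⟨l1, l2, l3, l4, l5, l6, l7, l8, l9, l10⟩ := hlD
    have hl : G.Adj l c1 ∨ G.Adj l c2 ∨ G.Adj l c3 := by grind
    obtain ⟨f, hfw, hfl⟩ := hG.nondom w l hlw.symm
    exact c_ll T B hw1 w6 w8 w9 w10 w7 hwu hwb hwu2 hm4 hmu1 hm1 m6 m8 m9 m7 m10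
      l6 l10 l8 l7 l9 hl hlw hfw hfl

theorem exists_fin5 (k : Fin 5) (P : Fin 5 → Prop) :
    (∃ i, P i) ↔ (P k ∨ P (k + 1) ∨ P (k + 2) ∨ P (k + 3) ∨ P (k + 4)) := by
  have key : ∀ k i : Fin 5, i = k ∨ i = k + 1 ∨ i = k + 2 ∨ i = k + 3 ∨ i = k + 4 := by decide
  constructor
  · rintro ⟨i, hi⟩
    rcases key k i with h | h | h | h | h <;> rw [h] at hi <;> simp only [hi, true_or, or_true]
  · rintro (h | h | h | h | h) <;> exact ⟨_, h⟩

theorem near_rot {V : Type} (G : SimpleGraph V) (c : Fin 5 → V) (k : Fin 5) (u : V) :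
    Near G c u ↔ Near G ![c k, c (k + 1), c (k + 2), c (k + 3), c (k + 4)] u := by
  rw [near_mk, Near, exists_fin5 k]
  constructor
  · rintro ((h | h) | (h | h) | (h | h) | (h | h) | (h | h)) <;> simp only [h, true_or, or_true]
  · rintro (h | h | h | h | h | h | h | h | h | h) <;> simp only [h, true_or, or_true]

theorem near_rev {V : Type} (G : SimpleGraph V) (x0 x1 x2 x3 x4 u : V) :
    Near G ![x0, x1, x2, x3, x4] u ↔ Near G ![x0, x4, x3, x2, x1] u := by
  rw [near_mk, near_mk]
  constructor <;>
  · rintro (h | h | h | h | h | h | h | h | h | h) <;> simp only [h, true_or, or_true]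

theorem minCex_no_broken_diamond {V : Type} [Fintype V]
    (G : SimpleGraph V) (hG : MinCex G) (c : Fin 5 → V) (hc : GoodC5 G c)
    (u1 u2 : V) (h1 : distC G c u1 = 2) (h2 : distC G c u2 = 2)
    (hadj : G.Adj u1 u2) (k : Fin 5) (a1 b1 : V)
    (ha1 : G.Adj (c k) a1) (ha1u : G.Adj a1 u1)
    (hb1 : G.Adj (c k) b1) (hb1c : b1 ∉ Set.range c) :
    G.Adj u1 b1 := by
  by_contra hub
  have T : TF G.Adj := TF_of hG.1 hG.2.1
  have hC := hc.1
  have g1 : 2 ≤ distC G c u1 := h1.ge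
  have g2 : 2 ≤ distC G c u2 := h2.ge
  have nn1 : ∀ i, ¬ G.Adj u1 (c i) := fun i h => by
    have := distC_lt_of_near (G := G) (c := c) (u := u1) ⟨i, Or.inr h⟩
    omega
  have nn2 : ∀ i, ¬ G.Adj u2 (c i) := fun i h => by
    have := distC_lt_of_near (G := G) (c := c) (u := u2) ⟨i, Or.inr h⟩
    omega
  have ht : ∃ t i, G.Adj t u2 ∧ G.Adj t (c i) := by
    obtain ⟨i, -, hi⟩ := Finset.exists_mem_eq_inf' Finset.univ_nonempty fun i => G.dist u2 (c i)
    have hi' : distC G c u2 = G.dist u2 (c i) := hi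
    obtain ⟨p, hp⟩ := SimpleGraph.exists_walk_of_dist_ne_zero (G := G) (u := u2) (v := c i)
      (by omega)
    have hp2 : p.length = 2 := by omega
    refine ⟨p.getVert 1, i, ?_, ?_⟩
    · have := p.adj_getVert_succ (i := 0) (by omega)
      simpa using this.symm
    · have := p.adj_getVert_succ (i := 1) (by omega)
      rwa [show 1 + 1 = p.length by omega, p.getVert_length] at this
  -- normalised cycle, in both orientations
  have e0 := hC.2 k
  have e1 := hC.2 (k + 1)
  have e2 := hC.2 (k + 2)
  have e3 := hC.2 (k + 3)
  have e4 := hC.2 (k + 4)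
  rw [show k + 1 + 1 = k + 2 by rw [add_assoc]; rfl] at e1
  rw [show k + 2 + 1 = k + 3 by rw [add_assoc]; rfl] at e2
  rw [show k + 3 + 1 = k + 4 by rw [add_assoc]; rfl] at e3
  rw [show k + 4 + 1 = k by rw [add_assoc]; exact add_zero k] at e4
  have hbne : ∀ i, b1 ≠ c i := fun i h => hb1c ⟨i, h.symm⟩
  have hbne1 := hbne (k + 1)
  have hbne4 := hbne (k + 4)
  have p0 := nn1 k
  have p1 := nn1 (k + 1)
  have p2 := nn1 (k + 2)
  have p3 := nn1 (k + 3)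
  have p4 := nn1 (k + 4)
  have q0 := nn2 k
  have q1 := nn2 (k + 1)
  have q2 := nn2 (k + 2)
  have q3 := nn2 (k + 3)
  have q4 := nn2 (k + 4)
  have hnear := near_rot G c k
  have hnear' := fun u => (near_rot G c k u).trans (near_rev G _ _ _ _ _ u)
  obtain ⟨t, ht⟩ := ht
  rw [exists_fin5 k] at ht
  have ht1 : G.Adj t u2 ∧ (G.Adj t (c k) ∨ G.Adj t (c (k + 1)) ∨ G.Adj t (c (k + 2)) ∨
      G.Adj t (c (k + 3)) ∨ G.Adj t (c (k + 4))) := by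
    rcases ht with h | h | h | h | h <;> simp only [h, true_or, or_true, and_self]
  have ht2 : G.Adj t u2 ∧ (G.Adj t (c k) ∨ G.Adj t (c (k + 4)) ∨ G.Adj t (c (k + 3)) ∨
      G.Adj t (c (k + 2)) ∨ G.Adj t (c (k + 1))) := by
    rcases ht with h | h | h | h | h <;> simp only [h, true_or, or_true, and_self]
  have hcase : (G.Adj a1 (c (k + 2)) ∧ G.Adj b1 (c (k + 3))) ∨
      (G.Adj a1 (c (k + 3)) ∧ G.Adj b1 (c (k + 2))) := by
    have f1 := T.frk (c k) (c (k + 4)) b1 a1 u1 (c (k + 1)) (c (k + 2))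
    have f2 := T.frk (c k) (c (k + 1)) b1 a1 u1 (c (k + 4)) (c (k + 3))
    have symm := T.symm
    have irr := T.irr
    have tri := T.tri
    clear hnear hnear' hbne nn1 nn2 ht ht1 ht2 hc hG hC T
    generalize c k = c0 at *
    generalize c (k + 1) = c1 at *
    generalize c (k + 2) = c2 at *
    generalize c (k + 3) = c3 at *
    generalize c (k + 4) = c4 at *
    grind (splits := 60)
  rcases hcase with ⟨ha, hb⟩ | ⟨ha, hb⟩
  · exact core_false hG hc hnear ⟨_, rfl⟩ ⟨_, rfl⟩ g1 g2 ⟨t, ht1⟩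
      ⟨e0, e1, e2, e3, e4, hadj, ha1u.symm, hub, p0, p1, p2, p3, p4, q0, q1, q2, q3, q4,
        ha1.symm, ha, hb1.symm, hb, hbne1, hbne4⟩
  · exact core_false hG hc hnear' ⟨_, rfl⟩ ⟨_, rfl⟩ g1 g2 ⟨t, ht2⟩
      ⟨e4.symm, e3.symm, e2.symm, e1.symm, e0.symm, hadj, ha1u.symm, hub, p0, p4, p3, p2, p1,
        q0, q4, q3, q2, q1, ha1.symm, ha, hb1.symm, hb, hbne4, hbne1⟩
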